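/- (Corollary 2.3.) Suppose that for every ρ ∈ (0, +∞) the hypotheses (a), (b), (c) of Theorem 2.2 hold, i.e.: f : Π_ρ → ℝ is continuous with f ≥ δ̲_ρ on Π_ρ for some continuous δ̲_ρ : [0,1] → [0,∞); H : K̄_ρ → ℝ is continuous and bounded with H[u] ≥ η̲_ρ ≥ 0 on ∂K_ρ; and η̲_ρ + ∫₀¹ δ̲_ρ(s) ds > 0. Then for every ρ ∈ (0, +∞) there exist λ_ρ ∈ (0, +∞) and a non-negative eigenfunction u_ρ ∈ ∂K_ρ satisfying u_ρ(t) = λ_ρ ( γ(t) H[u_ρ] + ∫₀¹ k(t,s) f(s, u_ρ(s), u_ρ′(s), u_ρ″(s), u_ρ‴(s)) ds ) on [0,1]. In particular there are uncountably many eigenvalue–eigenfunction pairs. -/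

import Mathlib

open Set MeasureTheory Filter Topology

/-- The Green's function `k(t,s) = (1/6)(3t²s − t³)` for `s ≥ t`,
`k(t,s) = (1/6)(3s²t − s³)` for `s ≤ t`. -/
noncomputable def kern (t s : ℝ) : ℝ :=
  if t ≤ s then (3 * t ^ 2 * s - t ^ 3) / 6 else (3 * s ^ 2 * t - s ^ 3) / 6

/-- `γ(t) = (1/6)(3t² − t³)`. -/
noncomputable def gam (t : ℝ) : ℝ := (3 * t ^ 2 - t ^ 3) / 6

/-- The sup norm over `[0,1]`: `‖w‖_∞ = sup_{t∈[0,1]} |w(t)|`. -/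
noncomputable def supN (w : ℝ → ℝ) : ℝ := ⨆ t : Icc (0:ℝ) 1, |w ↑t|

/-- The `C³[0,1]` norm `‖u‖₃ = max_{j=0,…,3} ‖u⁽ʲ⁾‖_∞`. -/
noncomputable def norm3 (u : ℝ → ℝ) : ℝ :=
  max (max (supN u) (supN (deriv u))) (max (supN (deriv^[2] u)) (supN (deriv^[3] u)))

/-- The cone `K = {u ∈ C³[0,1] : u, u′, u″, −u‴ ≥ 0 on [0,1]}`, where elements of
`C³[0,1]` are represented by three times continuously differentiable functions on `ℝ`. -/
def coneK : Set (ℝ → ℝ) :=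
  {u | ContDiff ℝ 3 u ∧ ∀ t ∈ Icc (0:ℝ) 1,
    0 ≤ u t ∧ 0 ≤ deriv u t ∧ 0 ≤ deriv^[2] u t ∧ 0 ≤ -(deriv^[3] u t)}

/-- `K̄_ρ = {u ∈ K : ‖u‖₃ ≤ ρ}`. -/
def Kbar (ρ : ℝ) : Set (ℝ → ℝ) := {u ∈ coneK | norm3 u ≤ ρ}

/-- `∂K_ρ = {u ∈ K : ‖u‖₃ = ρ}`. -/
def Kbdry (ρ : ℝ) : Set (ℝ → ℝ) := {u ∈ coneK | norm3 u = ρ}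

/-- `Π_ρ = [0,1] × [0,ρ]³ × [−ρ,0]`. -/
def PiSet (ρ : ℝ) : Set (ℝ × ℝ × ℝ × ℝ × ℝ) :=
  {p | p.1 ∈ Icc (0:ℝ) 1 ∧ p.2.1 ∈ Icc 0 ρ ∧ p.2.2.1 ∈ Icc 0 ρ ∧
       p.2.2.2.1 ∈ Icc 0 ρ ∧ p.2.2.2.2 ∈ Icc (-ρ) 0}

/-- The operator `Tu(t) = γ(t)H[u] + ∫₀¹ k(t,s) f(s, u(s), u′(s), u″(s), u‴(s)) ds`. -/
noncomputable def Toper (f : ℝ × ℝ × ℝ × ℝ × ℝ → ℝ) (H : (ℝ → ℝ) → ℝ) (u : ℝ → ℝ) :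
    ℝ → ℝ :=
  fun t => gam t * H u +
    ∫ s in (0:ℝ)..1, kern t s * f (s, u s, deriv u s, deriv^[2] u s, deriv^[3] u s)

/-- Continuity of a functional `H` on a subset `S` of `C³[0,1]` with respect to `‖·‖₃`. -/
def ContOn3 (H : (ℝ → ℝ) → ℝ) (S : Set (ℝ → ℝ)) : Prop :=
  ∀ u ∈ S, ∀ ε > (0:ℝ), ∃ δ > (0:ℝ), ∀ v ∈ S, norm3 (u - v) < δ → |H u - H v| < ε

/-- Boundedness of a functional `H` on a subset `S` of `C³[0,1]`. -/
def BddOn3 (H : (ℝ → ℝ) → ℝ) (S : Set (ℝ → ℝ)) : Prop :=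
  ∃ M : ℝ, ∀ u ∈ S, |H u| ≤ M

/-- Evaluating at `1` the polynomial `t ↦ det (1 + t A)` by Lagrange interpolation from nodes
close to `0`, with weights that do not depend on `A`. -/
theorem exists_det_interpolation (E : Type*) [NormedAddCommGroup E] [NormedSpace ℝ E]
    [FiniteDimensional ℝ E] {ε : ℝ} (hε : 0 < ε) :
    ∃ (s : Finset ℕ) (v w : ℕ → ℝ), (∀ i, v i ∈ Ioo 0 ε) ∧ ∑ i ∈ s, w i = 1 ∧
      ∀ A : E →L[ℝ] E, (1 + A).det = ∑ i ∈ s, w i * (1 + v i • A).det := by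
  classical
  set n := Module.finrank ℝ E
  let s := Finset.range (n + 1)
  let v : ℕ → ℝ := fun i => ε / (i + 2)
  have hv : Set.InjOn v s := by
    intro i _ j _ h
    have : ε / ((i:ℝ) + 2) = ε / ((j:ℝ) + 2) := h
    field_simp at this
    exact_mod_cast (by linarith : (i:ℝ) = j)
  have interp : ∀ P : Polynomial ℝ, P.natDegree ≤ n →
      P.eval 1 = ∑ i ∈ s, (Lagrange.basis s v i).eval 1 * P.eval (v i) := by
    intro P hP
    have hdeg : P.degree < s.card := by
      refine lt_of_le_of_lt Polynomial.degree_le_natDegree ?_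
      simp only [s, Finset.card_range]
      exact_mod_cast Nat.lt_succ_of_le hP
    conv_lhs => rw [Lagrange.eq_interpolate hv hdeg]
    simp [Lagrange.interpolate_apply, Polynomial.eval_finsetSum, mul_comm]
  refine ⟨s, v, fun i => (Lagrange.basis s v i).eval 1, fun i => ⟨by positivity, ?_⟩, ?_, ?_⟩
  · have : (1:ℝ) < (i:ℝ) + 2 := by linarith [(Nat.cast_nonneg i : (0:ℝ) ≤ i)]
    exact div_lt_self hε this
  · simpa using (interp 1 (by simp)).symm
  · intro A
    let b := Module.finBasis ℝ E
    let M := LinearMap.toMatrix b b (A : E →ₗ[ℝ] E)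
    let P : Polynomial ℝ :=
      ((Polynomial.X : Polynomial ℝ) • M.map Polynomial.C +
        (1 : Matrix (Fin n) (Fin n) ℝ).map Polynomial.C).det
    have hP : ∀ t : ℝ, P.eval t = (1 + t • A).det := by
      intro t
      have h1 : (1 + t • A).det = LinearMap.det ((1 : E →ₗ[ℝ] E) + t • (A : E →ₗ[ℝ] E)) := rfl
      have h2 : LinearMap.toMatrix b b (1 + t • (A : E →ₗ[ℝ] E)) = 1 + t • M := by
        rw [map_add, map_smul]
        congr 1
        exact LinearMap.toMatrix_one b
      rw [h1, ← LinearMap.det_toMatrix b, h2]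
      simp only [P]
      rw [← Polynomial.coe_evalRingHom, RingHom.map_det]
      congr 1
      ext i j
      rcases eq_or_ne i j with rfl | h
      · simp
        ring
      · simp [h]
        ring
    have hdeg : P.natDegree ≤ n :=
      (Polynomial.natDegree_det_X_add_C_le M 1).trans_eq (Fintype.card_fin _)
    have := interp P hdeg
    simpa [hP] using this

/-- If `r` maps the closed unit ball to the unit sphere and fixes the sphere, then `x + t (r x - x)`
is, for small `t`, a bijection of the open ball, so its Jacobian determinant integrates to the
volume of the ball. -/
theorem exists_pos_setIntegral_det_eq {E : Type*} [NormedAddCommGroup E] [NormedSpace ℝ E]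
    [FiniteDimensional ℝ E] [MeasurableSpace E] [BorelSpace E] (μ : Measure E)
    [μ.IsAddHaarMeasure] {U : Set E} (hU : IsOpen U) (hBU : Metric.closedBall (0:E) 1 ⊆ U)
    {r : E → E} (hr : ContDiffOn ℝ 1 r U)
    (hr1 : ∀ x ∈ Metric.closedBall (0:E) 1, ‖r x‖ = 1) (hrid : ∀ x : E, ‖x‖ = 1 → r x = x) :
    ∃ ε > (0:ℝ), ∀ t ∈ Ioo 0 ε,
      ∫ x in Metric.ball (0:E) 1, (1 + t • (fderiv ℝ r x - 1)).det ∂μ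
        = μ.real (Metric.ball (0:E) 1) := by
  have hstrict : ∀ x ∈ Metric.closedBall (0:E) 1, HasStrictFDerivAt r (fderiv ℝ r x) x :=
    fun x hx => (hr.contDiffAt (hU.mem_nhds (hBU hx))).hasStrictFDerivAt (by simp)
  have hcont : ContinuousOn (fun x => fderiv ℝ r x - 1) (Metric.closedBall (0:E) 1) :=
    ((hr.continuousOn_fderiv_of_isOpen hU le_rfl).mono hBU).sub continuousOn_const
  obtain ⟨C, hC⟩ := (isCompact_closedBall (0:E) 1).exists_bound_of_continuousOn hcont
  have hC0 : 0 ≤ C := (norm_nonneg _).trans (hC 0 (by simp))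
  have hlip : ∀ x ∈ Metric.closedBall (0:E) 1, ∀ y ∈ Metric.closedBall (0:E) 1,
      ‖(r y - y) - (r x - x)‖ ≤ C * ‖y - x‖ := fun x hx y hy =>
    (convex_closedBall (0:E) 1).norm_image_sub_le_of_norm_hasFDerivWithin_le (f := fun x => r x - x)
      (fun z hz => ((hstrict z hz).hasFDerivAt.sub (hasFDerivAt_id z)).hasFDerivWithinAt) hC hx hy
  have hdet : ∀ᶠ A : E →L[ℝ] E in 𝓝 0, 0 < (1 + A).det := by
    have h1 : Continuous fun A : E →L[ℝ] E => (1 + A).det :=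
      ContinuousLinearMap.continuous_det.comp (continuous_const.add continuous_id)
    refine h1.continuousAt.eventually (lt_mem_nhds ?_)
    have : (1 + (0 : E →L[ℝ] E)).det = LinearMap.det (1 : E →ₗ[ℝ] E) := by rw [add_zero]; rfl
    change 0 < (1 + (0 : E →L[ℝ] E)).det
    rw [this, map_one]
    exact one_pos
  obtain ⟨δ, hδ, hdet⟩ := Metric.eventually_nhds_iff.1 hdet
  refine ⟨min 1 (min 1 δ / (C + 1)), by positivity, fun t ht => ?_⟩
  obtain ⟨ht0, ht⟩ := ht
  obtain ⟨ht1, ht⟩ := lt_min_iff.1 ht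
  rw [lt_div_iff₀ (by positivity)] at ht
  have htC : t * C < min 1 δ := by nlinarith
  obtain ⟨htC1, htCδ⟩ := lt_min_iff.1 htC
  set φ : E → E := fun x => x + t • (r x - x) with hφ
  set φ' : E → E →L[ℝ] E := fun x => 1 + t • (fderiv ℝ r x - 1) with hφ'
  have hφd : ∀ x ∈ Metric.closedBall (0:E) 1, HasStrictFDerivAt φ (φ' x) x := fun x hx =>
    (hasStrictFDerivAt_id x).add (((hstrict x hx).sub (hasStrictFDerivAt_id x)).const_smul t)
  have hpos : ∀ x ∈ Metric.closedBall (0:E) 1, 0 < (φ' x).det := fun x hx => by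
    apply hdet
    rw [dist_zero_right, norm_smul, Real.norm_of_nonneg ht0.le]
    exact (mul_le_mul_of_nonneg_left (hC x hx) ht0.le).trans_lt htCδ
  have hinj : InjOn φ (Metric.closedBall (0:E) 1) := by
    intro x hx y hy hxy
    have h1 : y - x = - (t • ((r y - y) - (r x - x))) := by
      simp only [hφ] at hxy
      linear_combination (norm := module) (-1 : ℝ) • hxy
    have h2 : ‖y - x‖ ≤ t * (C * ‖y - x‖) := by
      conv_lhs => rw [h1, norm_neg, norm_smul, Real.norm_of_nonneg ht0.le]
      exact mul_le_mul_of_nonneg_left (hlip x hx y hy) ht0.le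
    have h3 : ‖y - x‖ = 0 := by nlinarith [norm_nonneg (y - x)]
    exact (sub_eq_zero.1 (norm_eq_zero.1 h3)).symm
  have hsub := Metric.ball_subset_closedBall (x := (0:E)) (ε := 1)
  have hmaps : MapsTo φ (Metric.ball (0:E) 1) (Metric.ball (0:E) 1) := by
    intro x hx
    rw [mem_ball_zero_iff] at hx ⊢
    have : φ x = (1 - t) • x + t • r x := by simp only [hφ]; module
    calc ‖φ x‖ ≤ (1 - t) * ‖x‖ + t * 1 := by
          rw [this]
          refine (norm_add_le _ _).trans_eq ?_
          rw [norm_smul, norm_smul, hr1 x (hsub (by simpa using hx)),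
            Real.norm_of_nonneg ht0.le, Real.norm_of_nonneg (by linarith)]
      _ < 1 := by nlinarith
  have hopen : IsOpen (φ '' Metric.ball (0:E) 1) := by
    rw [isOpen_iff_mem_nhds]
    rintro _ ⟨x, hx, rfl⟩
    have hd := hφd x (hsub hx)
    rw [← (φ' x).coe_toContinuousLinearEquivOfDetNeZero (hpos x (hsub hx)).ne'] at hd
    rw [← hd.map_nhds_eq_of_equiv]
    exact image_mem_map (Metric.isOpen_ball.mem_nhds hx)
  have himage : φ '' Metric.ball (0:E) 1 = Metric.ball (0:E) 1 := by
    refine hmaps.image_subset.antisymm ?_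
    have hK : IsCompact (φ '' Metric.closedBall (0:E) 1) :=
      (isCompact_closedBall (0:E) 1).image_of_continuousOn
        fun x hx => (hφd x hx).continuousAt.continuousWithinAt
    refine (convex_ball (0:E) 1).isPreconnected.subset_of_closure_inter_subset hopen ?_ ?_
    · exact ⟨φ 0, hmaps (by simp), mem_image_of_mem _ (by simp)⟩
    · rintro y ⟨hy, hyB⟩
      obtain ⟨x, hx, rfl⟩ := closure_minimal (image_mono hsub) hK.isClosed hy
      refine mem_image_of_mem _ ?_
      rw [mem_closedBall_zero_iff] at hx
      rw [mem_ball_zero_iff] at hyB ⊢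
      refine lt_of_le_of_ne hx fun h => ?_
      have : φ x = x := by simp [hφ, hrid x h]
      rw [this] at hyB
      exact hyB.ne h
  have key := integral_image_eq_integral_abs_det_fderiv_smul μ Metric.isOpen_ball.measurableSet
    (fun x hx => (hφd x (hsub hx)).hasFDerivAt.hasFDerivWithinAt) (hinj.mono hsub)
    (fun _ => (1:ℝ))
  rw [himage] at key
  simp only [smul_eq_mul, mul_one, integral_const, MeasurableSet.univ, measureReal_restrict_apply,
    univ_inter] at key
  rw [key]
  exact setIntegral_congr_fun Metric.isOpen_ball.measurableSet
    fun x hx => (abs_of_pos (hpos x (hsub hx))).symm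

/-- There is no continuously differentiable retraction of the closed unit ball onto the sphere. -/
theorem not_exists_contDiffOn_retraction {E : Type*} [NormedAddCommGroup E] [InnerProductSpace ℝ E]
    [FiniteDimensional ℝ E] {U : Set E} (hU : IsOpen U) (hBU : Metric.closedBall (0:E) 1 ⊆ U)
    {r : E → E} (hr : ContDiffOn ℝ 1 r U)
    (hr1 : ∀ x ∈ Metric.closedBall (0:E) 1, ‖r x‖ = 1) (hrid : ∀ x : E, ‖x‖ = 1 → r x = x) :
    False := by
  borelize E
  let μ : Measure E := Measure.addHaar
  obtain ⟨ε, hε, hint⟩ := exists_pos_setIntegral_det_eq μ hU hBU hr hr1 hrid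
  obtain ⟨s, v, w, hv, hw, hdet⟩ := exists_det_interpolation E hε
  have hsub := Metric.ball_subset_closedBall (x := (0:E)) (ε := 1)
  have hcont : ContinuousOn (fun x => fderiv ℝ r x - 1) (Metric.closedBall (0:E) 1) :=
    ((hr.continuousOn_fderiv_of_isOpen hU le_rfl).mono hBU).sub continuousOn_const
  have hzero : ∀ x ∈ Metric.ball (0:E) 1, (1 + (fderiv ℝ r x - 1)).det = 0 := by
    intro x hx
    by_contra hne
    rw [add_sub_cancel] at hne
    have hd : HasFDerivAt r (fderiv ℝ r x) x :=
      ((hr.contDiffAt (hU.mem_nhds (hBU (hsub hx)))).differentiableAt (by simp)).hasFDerivAt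
    have h1 := hd.norm_sq
    have h2 : HasFDerivAt (fun y => ‖r y‖ ^ 2) (0 : E →L[ℝ] ℝ) x := by
      refine (hasFDerivAt_const (1:ℝ) x).congr_of_eventuallyEq ?_
      filter_upwards [Metric.isOpen_ball.mem_nhds hx] with y hy
      simp [hr1 y (hsub hy)]
    have h3 := h1.unique h2
    let e := (fderiv ℝ r x).toContinuousLinearEquivOfDetNeZero hne
    have h4 := congrArg (fun L : E →L[ℝ] ℝ => L (e.symm (r x))) h3
    have h5 : fderiv ℝ r x (e.symm (r x)) = r x := e.apply_symm_apply (r x)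
    simp [h5, hr1 x (hsub hx)] at h4
  have h0 : ∫ x in Metric.ball (0:E) 1,
      ∑ i ∈ s, w i * (1 + v i • (fderiv ℝ r x - 1)).det ∂μ = 0 :=
    setIntegral_eq_zero_of_forall_eq_zero fun x hx => by rw [← hdet, hzero x hx]
  rw [integral_finsetSum] at h0
  · simp_rw [integral_const_mul, hint _ (hv _), ← Finset.sum_mul, hw, one_mul] at h0
    have : 0 < μ.real (Metric.ball (0:E) 1) :=
      ENNReal.toReal_pos (Metric.measure_ball_pos μ _ one_pos).ne' measure_ball_lt_top.ne
    exact this.ne' h0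
  · intro i _
    refine Integrable.const_mul ?_ _
    refine IntegrableOn.mono_set ?_ hsub
    refine ContinuousOn.integrableOn_compact (isCompact_closedBall _ _) ?_
    exact ContinuousLinearMap.continuous_det.comp_continuousOn
      (continuousOn_const.add (hcont.const_smul (v i)))

/-- Brouwer's theorem for continuously differentiable maps: without a fixed point, following the
ray from `f x` through `x` to the sphere would give a retraction. -/
theorem exists_fixedPoint_of_contDiff {E : Type*} [NormedAddCommGroup E] [InnerProductSpace ℝ E]
    [FiniteDimensional ℝ E] {f : E → E} (hf : ContDiff ℝ 1 f)
    (hf1 : ∀ x ∈ Metric.closedBall (0:E) 1, ‖f x‖ < 1) :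
    ∃ x ∈ Metric.closedBall (0:E) 1, f x = x := by
  by_contra! hne
  set d : E → E := fun x => x - f x with hd
  set D : E → ℝ := fun x => inner ℝ x (d x) ^ 2 + ‖d x‖ ^ 2 * (1 - ‖x‖ ^ 2) with hD
  set s : E → ℝ := fun x => (-inner ℝ x (d x) + √(D x)) / ‖d x‖ ^ 2 with hs
  have hdc : ContDiff ℝ 1 d := contDiff_id.sub hf
  have hDc : ContDiff ℝ 1 D := ((contDiff_id.inner ℝ hdc).pow 2).add
    ((hdc.norm_sq ℝ).mul (contDiff_const.sub (contDiff_id.norm_sq ℝ)))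
  have hd0 : ∀ x ∈ Metric.closedBall (0:E) 1, d x ≠ 0 := fun x hx h =>
    hne x hx (sub_eq_zero.1 h).symm
  have hb : ∀ x : E, ‖x‖ = 1 → 0 < inner ℝ x (d x) := by
    intro x hx
    have h1 := real_inner_le_norm x (f x)
    have h2 := hf1 x (by simp [hx])
    rw [hd, inner_sub_right, real_inner_self_eq_norm_sq, hx]
    rw [hx] at h1
    linarith
  have hDpos : ∀ x ∈ Metric.closedBall (0:E) 1, 0 < D x := by
    intro x hx
    rcases (mem_closedBall_zero_iff.1 hx).lt_or_eq with h | h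
    · have : 0 < ‖d x‖ := norm_pos_iff.2 (hd0 x hx)
      have h2 : 0 < 1 - ‖x‖ ^ 2 := by nlinarith [norm_nonneg x]
      positivity
    · have := hb x h
      simp only [hD, h]
      nlinarith
  refine not_exists_contDiffOn_retraction (U := {x | d x ≠ 0} ∩ {x | 0 < D x})
    (r := fun x => x + s x • d x) ?_ (fun x hx => ⟨hd0 x hx, hDpos x hx⟩) ?_ ?_ ?_
  · exact (isOpen_ne_fun hdc.continuous continuous_const).inter
      (isOpen_lt continuous_const hDc.continuous)
  · intro x hx
    refine ContDiffAt.contDiffWithinAt ?_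
    refine contDiffAt_id.add (ContDiffAt.smul ?_ hdc.contDiffAt)
    refine ContDiffAt.div ?_ (hdc.norm_sq ℝ).contDiffAt (by simpa using hx.1)
    exact (contDiff_id.inner ℝ hdc).contDiffAt.neg.add (hDc.contDiffAt.sqrt (ne_of_gt hx.2))
  · intro x hx
    have h1 : ‖d x‖ ^ 2 ≠ 0 := by simpa using hd0 x hx
    have h2 := Real.sq_sqrt (hDpos x hx).le
    have h3 : ‖x + s x • d x‖ ^ 2 = 1 := by
      rw [norm_add_sq_real, inner_smul_right, norm_smul, mul_pow, Real.norm_eq_abs, sq_abs]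
      have h4 : s x * ‖d x‖ ^ 2 = -inner ℝ x (d x) + √(D x) := div_mul_cancel₀ _ h1
      have h5 : ‖d x‖ ^ 2 * (‖x‖ ^ 2 + 2 * (s x * inner ℝ x (d x)) + s x ^ 2 * ‖d x‖ ^ 2 - 1)
          = 0 := by
        have h6 : D x = inner ℝ x (d x) ^ 2 + ‖d x‖ ^ 2 * (1 - ‖x‖ ^ 2) := rfl
        rw [h6] at h2
        rw [h6] at h4
        linear_combination h2 + (2 * inner ℝ x (d x) + s x * ‖d x‖ ^ 2 +
          (-inner ℝ x (d x) + √(inner ℝ x (d x) ^ 2 + ‖d x‖ ^ 2 * (1 - ‖x‖ ^ 2)))) * h4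
      have := (mul_eq_zero.1 h5).resolve_left h1
      linarith
    exact (pow_eq_one_iff_of_nonneg (norm_nonneg _) two_ne_zero).1 h3
  · intro x hx
    have : s x = 0 := by simp [hs, hD, hx, Real.sqrt_sq (hb x hx).le]
    simp [this]

/-- **Brouwer fixed point theorem** on the unit ball. -/
theorem exists_fixedPoint_of_mapsTo_closedBall {E : Type*} [NormedAddCommGroup E]
    [InnerProductSpace ℝ E] [FiniteDimensional ℝ E] {f : E → E} (hf : Continuous f)
    (hf1 : MapsTo f (Metric.closedBall (0:E) 1) (Metric.closedBall (0:E) 1)) :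
    ∃ x ∈ Metric.closedBall (0:E) 1, f x = x := by
  obtain ⟨x, hx, hmin⟩ := (isCompact_closedBall (0:E) 1).exists_isMinOn ⟨0, by simp⟩
    (hf.sub continuous_id).norm.continuousOn
  refine ⟨x, hx, ?_⟩
  by_contra hne
  set m := ‖f x - x‖ with hm
  have hm0 : 0 < m := norm_pos_iff.2 (sub_ne_zero.2 hne)
  obtain ⟨g, hg, hgf, -⟩ := hf.exists_contDiff_approx 1 (ε := fun _ => m / 4) continuous_const
    (fun _ => by positivity)
  have hg1 : ∀ y ∈ Metric.closedBall (0:E) 1, ‖(1 + m / 4)⁻¹ • g y‖ < 1 := by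
    intro y hy
    have h1 := hgf y
    have h2 := mem_closedBall_zero_iff.1 (hf1 hy)
    rw [dist_eq_norm] at h1
    have h3 : ‖g y‖ < 1 + m / 4 := by
      have := norm_le_norm_add_norm_sub' (g y) (f y)
      linarith
    rw [norm_smul, norm_inv, Real.norm_of_nonneg (by positivity), inv_mul_lt_one₀ (by positivity)]
    exact h3
  obtain ⟨y, hy, hfix⟩ := exists_fixedPoint_of_contDiff (hg.const_smul (1 + m / 4)⁻¹) hg1
  have h1 : g y = (1 + m / 4) • y :=
    (inv_smul_eq_iff₀ (by positivity : 1 + m / 4 ≠ 0)).1 hfix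
  have h2 : ‖f y - y‖ ≤ m / 4 + m / 4 := by
    have h3 : f y - y = (f y - g y) + (m / 4) • y := by rw [h1]; module
    rw [h3]
    refine (norm_add_le _ _).trans (add_le_add ?_ ?_)
    · rw [← dist_eq_norm, dist_comm]; exact (hgf y).le
    · rw [norm_smul, Real.norm_of_nonneg (by positivity)]
      exact mul_le_of_le_one_right (by positivity) (mem_closedBall_zero_iff.1 hy)
  have h3 : m ≤ ‖f y - y‖ := hmin hy
  linarith

/-- A continuous retraction of `ι → ℝ` onto the standard simplex. -/
theorem exists_continuous_retraction_stdSimplex (ι : Type*) [Fintype ι] [Nonempty ι] :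
    ∃ r : (ι → ℝ) → ι → ℝ, Continuous r ∧ (∀ x, r x ∈ stdSimplex ℝ ι) ∧
      ∀ x ∈ stdSimplex ℝ ι, r x = x := by
  have hcard : (Fintype.card ι : ℝ) ≠ 0 := by simp
  refine ⟨fun x i => (max (x i) 0 + max (1 - ∑ j, max (x j) 0) 0 / Fintype.card ι) /
    max 1 (∑ j, max (x j) 0), ?_, fun x => ⟨fun i => by positivity, ?_⟩, fun x hx => ?_⟩
  · refine continuous_pi fun i => Continuous.div (by fun_prop) (by fun_prop) fun x => ?_
    positivity
  · rw [← Finset.sum_div, Finset.sum_add_distrib, Finset.sum_const, Finset.card_univ, nsmul_eq_mul,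
      mul_div_cancel₀ _ hcard, div_eq_one_iff_eq (by positivity)]
    rcases le_total 1 (∑ j, max (x j) 0) with h | h
    · rw [max_eq_right h, max_eq_right (by linarith), add_zero]
    · rw [max_eq_left h, max_eq_left (by linarith)]; ring
  · have h1 : ∀ i, max (x i) 0 = x i := fun i => max_eq_left (hx.1 i)
    funext i
    simp [h1, hx.2]

/-- **Schauder fixed point theorem**. -/
theorem exists_fixedPoint_of_isCompact_convex {V : Type*} [NormedAddCommGroup V] [NormedSpace ℝ V]
    {C : Set V} (hC : IsCompact C) (hconv : Convex ℝ C) (hne : C.Nonempty) {Φ : V → V}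
    (hΦ : ContinuousOn Φ C) (hmaps : MapsTo Φ C C) : ∃ v ∈ C, Φ v = v := by
  obtain ⟨v₀, hv₀, hmin⟩ := hC.exists_isMinOn hne (hΦ.sub continuousOn_id).norm
  refine ⟨v₀, hv₀, ?_⟩
  by_contra hfix
  set m := ‖Φ v₀ - v₀‖ with hm
  have hm0 : 0 < m := norm_pos_iff.2 (sub_ne_zero.2 hfix)
  obtain ⟨t, htC, htfin, hcover⟩ := hC.finite_cover_balls (half_pos hm0)
  have : Fintype t := htfin.fintype
  have : Nonempty t := by
    obtain ⟨i, hi, -⟩ := mem_iUnion₂.1 (hcover hv₀)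
    exact ⟨⟨i, hi⟩⟩
  obtain ⟨r, hr, hrmem, hrid⟩ := exists_continuous_retraction_stdSimplex t
  let q : t → V → ℝ := fun i v => max (m / 2 - dist v i) 0
  have hq : ∀ i, Continuous (q i) := fun i => by fun_prop
  have hqpos : ∀ v ∈ C, 0 < ∑ i, q i v := by
    intro v hv
    obtain ⟨i, hi, hvi⟩ := mem_iUnion₂.1 (hcover hv)
    refine Finset.sum_pos' (fun j _ => le_max_right _ _) ⟨⟨i, hi⟩, Finset.mem_univ _, ?_⟩
    exact lt_max_of_lt_left (sub_pos.2 hvi)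
  let S : EuclideanSpace ℝ t → V := fun x => ∑ i, r x.ofLp i • (i : V)
  have hS : Continuous S := continuous_finsetSum _ fun i _ =>
    ((continuous_apply i).comp (hr.comp (PiLp.continuous_ofLp 2 _))).smul continuous_const
  have hSC : ∀ x, S x ∈ C := fun x =>
    hconv.sum_mem (fun i _ => (hrmem _).1 i) (hrmem _).2 fun i _ => htC i.2
  have hΦS : Continuous fun x => Φ (S x) := hΦ.comp_continuous hS hSC
  let G : EuclideanSpace ℝ t → EuclideanSpace ℝ t := fun x =>
    WithLp.toLp 2 fun i => q i (Φ (S x)) / ∑ j, q j (Φ (S x))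
  have hG : Continuous G := by
    refine (PiLp.continuous_toLp 2 _).comp (continuous_pi fun i => ?_)
    refine Continuous.div ((hq i).comp hΦS) (continuous_finsetSum _ fun j _ => (hq j).comp hΦS) ?_
    exact fun x => (hqpos _ (hmaps (hSC x))).ne'
  have hGmem : ∀ x, (G x).ofLp ∈ stdSimplex ℝ t := fun x => by
    refine ⟨fun i => div_nonneg (le_max_right _ _) (hqpos _ (hmaps (hSC x))).le, ?_⟩
    change ∑ i, q i (Φ (S x)) / ∑ j, q j (Φ (S x)) = 1
    rw [← Finset.sum_div, div_self (hqpos _ (hmaps (hSC x))).ne']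
  obtain ⟨x, -, hx⟩ := exists_fixedPoint_of_mapsTo_closedBall hG fun x _ => by
    rw [mem_closedBall_zero_iff, EuclideanSpace.norm_eq, Real.sqrt_le_one, ← (hGmem x).2]
    refine Finset.sum_le_sum fun i _ => ?_
    have h0 := (hGmem x).1 i
    have h1 := (mem_Icc_of_mem_stdSimplex (hGmem x) i).2
    rw [Real.norm_of_nonneg h0]
    nlinarith
  have hxmem := hGmem x
  have hxi : ∀ i, x.ofLp i = q i (Φ (S x)) / ∑ j, q j (Φ (S x)) := fun i =>
    congrArg (fun y : EuclideanSpace ℝ t => y.ofLp i) hx.symm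
  rw [hx] at hxmem
  have hSx : S x = ∑ i, x.ofLp i • (i : V) := by simp only [S, hrid _ hxmem]
  have hle : ‖Φ (S x) - S x‖ ≤ m / 2 := by
    have h1 : Φ (S x) - S x = ∑ i, x.ofLp i • (Φ (S x) - (i : V)) := by
      simp_rw [smul_sub, Finset.sum_sub_distrib, ← Finset.sum_smul]
      rw [hxmem.2, one_smul, ← hSx]
    rw [h1]
    calc ‖∑ i, x.ofLp i • (Φ (S x) - (i : V))‖
        ≤ ∑ i, x.ofLp i * (m / 2) := norm_sum_le_of_le _ fun i _ => ?_
      _ = m / 2 := by rw [← Finset.sum_mul, hxmem.2, one_mul]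
    rw [norm_smul, Real.norm_of_nonneg (hxmem.1 i), ← dist_eq_norm]
    rcases le_total (dist (Φ (S x)) (i : V)) (m / 2) with h | h
    · exact mul_le_mul_of_nonneg_left h (hxmem.1 i)
    · have : x.ofLp i = 0 := by simp [hxi, q, max_eq_right (sub_nonpos.2 h)]
      simp [this]
  have h3 : m ≤ ‖Φ (S x) - S x‖ := hmin (hSC x)
  linarith

/-- The integral of `w` from `0` to `t`. -/
noncomputable def headIntegral (w : ℝ → ℝ) (t : ℝ) : ℝ := ∫ s in (0:ℝ)..t, w s

/-- The integral of `w` from `t` to `1`. -/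
noncomputable def tailIntegral (w : ℝ → ℝ) (t : ℝ) : ℝ := ∫ s in t..(1:ℝ), w s

/-- The solution `u` of `u‴ = -w`, `u(0) = u′(0) = u″(1) = 0`. -/
noncomputable def cantilever (w : ℝ → ℝ) : ℝ → ℝ := headIntegral (headIntegral (tailIntegral w))

theorem hasDerivAt_headIntegral {w : ℝ → ℝ} (hw : Continuous w) (t : ℝ) :
    HasDerivAt (headIntegral w) (w t) t :=
  (hw.integral_hasStrictDerivAt 0 t).hasDerivAt

theorem tailIntegral_eq_neg (w : ℝ → ℝ) : tailIntegral w = fun t => -∫ s in (1:ℝ)..t, w s :=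
  funext fun _ => intervalIntegral.integral_symm _ _

theorem hasDerivAt_tailIntegral {w : ℝ → ℝ} (hw : Continuous w) (t : ℝ) :
    HasDerivAt (tailIntegral w) (-w t) t := by
  rw [tailIntegral_eq_neg]
  exact (hw.integral_hasStrictDerivAt 1 t).hasDerivAt.neg

theorem continuous_headIntegral {w : ℝ → ℝ} (hw : Continuous w) : Continuous (headIntegral w) :=
  continuous_iff_continuousAt.2 fun t => (hasDerivAt_headIntegral hw t).continuousAt

theorem continuous_tailIntegral {w : ℝ → ℝ} (hw : Continuous w) : Continuous (tailIntegral w) :=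
  continuous_iff_continuousAt.2 fun t => (hasDerivAt_tailIntegral hw t).continuousAt

theorem continuous_headIntegral_uncurry {X : Type*} [TopologicalSpace X]
    {w : X → ℝ → ℝ} (hw : Continuous fun p : X × ℝ => w p.1 p.2) :
    Continuous fun p : X × ℝ => headIntegral (w p.1) p.2 :=
  intervalIntegral.continuous_parametric_primitive_of_continuous hw

theorem continuous_tailIntegral_uncurry {X : Type*} [TopologicalSpace X]
    {w : X → ℝ → ℝ} (hw : Continuous fun p : X × ℝ => w p.1 p.2) :
    Continuous fun p : X × ℝ => tailIntegral (w p.1) p.2 := by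
  simp only [tailIntegral_eq_neg]
  exact (intervalIntegral.continuous_parametric_primitive_of_continuous hw).neg

theorem deriv_cantilever {w : ℝ → ℝ} (hw : Continuous w) :
    deriv (cantilever w) = headIntegral (tailIntegral w) :=
  funext fun t => (hasDerivAt_headIntegral
    (continuous_headIntegral (continuous_tailIntegral hw)) t).deriv

theorem iterate_two_deriv_cantilever {w : ℝ → ℝ} (hw : Continuous w) :
    deriv^[2] (cantilever w) = tailIntegral w := by
  change deriv (deriv (cantilever w)) = _
  rw [deriv_cantilever hw]
  exact funext fun t => (hasDerivAt_headIntegral (continuous_tailIntegral hw) t).deriv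

theorem iterate_three_deriv_cantilever {w : ℝ → ℝ} (hw : Continuous w) :
    deriv^[3] (cantilever w) = -w := by
  change deriv (deriv^[2] (cantilever w)) = _
  rw [iterate_two_deriv_cantilever hw]
  exact funext fun t => (hasDerivAt_tailIntegral hw t).deriv

theorem contDiff_succ_of_hasDerivAt {n : ℕ} {u u' : ℝ → ℝ} (h : ∀ t, HasDerivAt u (u' t) t)
    (hu' : ContDiff ℝ n u') : ContDiff ℝ (n + 1) u := by
  rw [contDiff_succ_iff_deriv, funext fun t => (h t).deriv]
  exact ⟨fun t => (h t).differentiableAt, by simp, hu'⟩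

theorem contDiff_cantilever {w : ℝ → ℝ} (hw : Continuous w) : ContDiff ℝ 3 (cantilever w) := by
  have h1 := continuous_tailIntegral hw
  have c0 : ContDiff ℝ ((0:ℕ)) fun t => -w t := contDiff_zero.2 hw.neg
  have c1 := contDiff_succ_of_hasDerivAt (hasDerivAt_tailIntegral hw) c0
  have c2 := contDiff_succ_of_hasDerivAt (n := 1) (hasDerivAt_headIntegral h1) (by simpa using c1)
  have c3 := contDiff_succ_of_hasDerivAt (n := 2)
    (hasDerivAt_headIntegral (continuous_headIntegral h1)) (by exact_mod_cast c2)
  exact_mod_cast c3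

theorem headIntegral_congr {v w : ℝ → ℝ} (h : ∀ t ∈ Icc (0:ℝ) 1, v t = w t) :
    ∀ t ∈ Icc (0:ℝ) 1, headIntegral v t = headIntegral w t := fun t ht =>
  intervalIntegral.integral_congr fun s hs => by
    rw [uIcc_of_le ht.1] at hs
    exact h s ⟨hs.1, hs.2.trans ht.2⟩

theorem tailIntegral_congr {v w : ℝ → ℝ} (h : ∀ t ∈ Icc (0:ℝ) 1, v t = w t) :
    ∀ t ∈ Icc (0:ℝ) 1, tailIntegral v t = tailIntegral w t := fun t ht =>
  intervalIntegral.integral_congr fun s hs => by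
    rw [uIcc_of_le ht.2] at hs
    exact h s ⟨ht.1.trans hs.1, hs.2⟩

theorem headIntegral_sub {v w : ℝ → ℝ} (hv : Continuous v) (hw : Continuous w) :
    headIntegral (v - w) = headIntegral v - headIntegral w :=
  funext fun t => by
    have h1 : IntervalIntegrable v volume 0 t := hv.intervalIntegrable _ _
    have h2 : IntervalIntegrable w volume 0 t := hw.intervalIntegrable _ _
    simp only [headIntegral, Pi.sub_apply]
    exact intervalIntegral.integral_sub h1 h2

theorem tailIntegral_sub {v w : ℝ → ℝ} (hv : Continuous v) (hw : Continuous w) :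
    tailIntegral (v - w) = tailIntegral v - tailIntegral w :=
  funext fun t => by
    have h1 : IntervalIntegrable v volume t 1 := hv.intervalIntegrable _ _
    have h2 : IntervalIntegrable w volume t 1 := hw.intervalIntegrable _ _
    simp only [tailIntegral, Pi.sub_apply]
    exact intervalIntegral.integral_sub h1 h2

theorem cantilever_sub {v w : ℝ → ℝ} (hv : Continuous v) (hw : Continuous w) :
    cantilever (v - w) = cantilever v - cantilever w := by
  have h1 := continuous_tailIntegral hv
  have h2 := continuous_tailIntegral hw
  rw [cantilever, tailIntegral_sub hv hw, headIntegral_sub h1 h2,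
    headIntegral_sub (continuous_headIntegral h1) (continuous_headIntegral h2)]
  rfl

theorem abs_headIntegral_le {w : ℝ → ℝ} {b : ℝ} (h : ∀ t ∈ Icc (0:ℝ) 1, |w t| ≤ b) :
    ∀ t ∈ Icc (0:ℝ) 1, |headIntegral w t| ≤ b := fun t ht => by
  have hb : 0 ≤ b := (abs_nonneg _).trans (h t ht)
  refine (intervalIntegral.norm_integral_le_of_norm_le_const (f := w)
    (a := 0) (b := t) (C := b) fun s hs => ?_).trans ?_
  · rw [uIoc_of_le ht.1] at hs
    exact h s ⟨hs.1.le, hs.2.trans ht.2⟩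
  · rw [sub_zero, abs_of_nonneg ht.1]
    exact mul_le_of_le_one_right hb ht.2

theorem abs_tailIntegral_le {w : ℝ → ℝ} {b : ℝ} (h : ∀ t ∈ Icc (0:ℝ) 1, |w t| ≤ b) :
    ∀ t ∈ Icc (0:ℝ) 1, |tailIntegral w t| ≤ b := fun t ht => by
  have hb : 0 ≤ b := (abs_nonneg _).trans (h t ht)
  refine (intervalIntegral.norm_integral_le_of_norm_le_const (f := w)
    (a := t) (b := 1) (C := b) fun s hs => ?_).trans ?_
  · rw [uIoc_of_le ht.2] at hs
    exact h s ⟨ht.1.trans hs.1.le, hs.2⟩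
  · rw [abs_of_nonneg (by linarith [ht.2])]
    exact mul_le_of_le_one_right hb (by linarith [ht.1])

theorem headIntegral_nonneg {w : ℝ → ℝ} (h : ∀ t ∈ Icc (0:ℝ) 1, 0 ≤ w t) :
    ∀ t ∈ Icc (0:ℝ) 1, 0 ≤ headIntegral w t := fun _ ht =>
  intervalIntegral.integral_nonneg ht.1 fun s hs => h s ⟨hs.1, hs.2.trans ht.2⟩

theorem tailIntegral_nonneg {w : ℝ → ℝ} (h : ∀ t ∈ Icc (0:ℝ) 1, 0 ≤ w t) :
    ∀ t ∈ Icc (0:ℝ) 1, 0 ≤ tailIntegral w t := fun _ ht =>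
  intervalIntegral.integral_nonneg ht.2 fun s hs => h s ⟨ht.1.trans hs.1, hs.2⟩

theorem supN_le {w : ℝ → ℝ} {b : ℝ} (h : ∀ t ∈ Icc (0:ℝ) 1, |w t| ≤ b) : supN w ≤ b :=
  ciSup_le fun t => h t t.2

theorem norm3_cantilever_le {w : ℝ → ℝ} (hw : Continuous w) {b : ℝ}
    (h : ∀ t ∈ Icc (0:ℝ) 1, |w t| ≤ b) : norm3 (cantilever w) ≤ b := by
  have h1 := abs_tailIntegral_le h
  rw [norm3, deriv_cantilever hw, iterate_two_deriv_cantilever hw,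
    iterate_three_deriv_cantilever hw]
  refine max_le (max_le (supN_le ?_) (supN_le ?_)) (max_le (supN_le h1) (supN_le ?_))
  · exact abs_headIntegral_le (abs_headIntegral_le h1)
  · exact abs_headIntegral_le h1
  · simpa using h

theorem cantilever_mem_Kbdry {w : ℝ → ℝ} (hw : Continuous w) {ρ : ℝ}
    (h : ∀ t ∈ Icc (0:ℝ) 1, w t ∈ Icc 0 ρ) (h0 : w 0 = ρ) : cantilever w ∈ Kbdry ρ := by
  have habs : ∀ t ∈ Icc (0:ℝ) 1, |w t| ≤ ρ := fun t ht =>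
    (abs_of_nonneg (h t ht).1).trans_le (h t ht).2
  have h2 := tailIntegral_nonneg fun t ht => (h t ht).1
  refine ⟨⟨contDiff_cantilever hw, fun t ht => ?_⟩, (norm3_cantilever_le hw habs).antisymm ?_⟩
  · rw [deriv_cantilever hw, iterate_two_deriv_cantilever hw, iterate_three_deriv_cantilever hw]
    exact ⟨headIntegral_nonneg (headIntegral_nonneg h2) t ht, headIntegral_nonneg h2 t ht, h2 t ht,
      by simpa using (h t ht).1⟩
  · refine le_trans ?_ (le_max_of_le_right (le_max_right _ _))
    rw [iterate_three_deriv_cantilever hw]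
    have hbdd : BddAbove (range fun t : Icc (0:ℝ) 1 => |(-w) t|) := by
      refine ⟨ρ, ?_⟩
      rintro _ ⟨t, rfl⟩
      simpa using habs t t.2
    refine le_trans ?_ (le_ciSup hbdd ⟨0, by simp⟩)
    simpa [h0] using le_abs_self ρ

theorem mem_PiSet_cantilever {w : ℝ → ℝ} {ρ : ℝ} (h : ∀ t ∈ Icc (0:ℝ) 1, w t ∈ Icc 0 ρ) :
    ∀ t ∈ Icc (0:ℝ) 1,
      (t, cantilever w t, headIntegral (tailIntegral w) t, tailIntegral w t, -w t) ∈ PiSet ρ := by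
  intro t ht
  have habs : ∀ t ∈ Icc (0:ℝ) 1, |w t| ≤ ρ := fun t ht =>
    (abs_of_nonneg (h t ht).1).trans_le (h t ht).2
  have h1 := abs_tailIntegral_le habs
  have h2 := tailIntegral_nonneg fun t ht => (h t ht).1
  have h3 := abs_headIntegral_le h1
  exact ⟨ht,
    ⟨headIntegral_nonneg (headIntegral_nonneg h2) t ht, le_of_abs_le (abs_headIntegral_le h3 t ht)⟩,
    ⟨headIntegral_nonneg h2 t ht, le_of_abs_le (h3 t ht)⟩,
    ⟨h2 t ht, le_of_abs_le (h1 t ht)⟩, neg_le_neg (h t ht).2, neg_nonpos.2 (h t ht).1⟩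

theorem cantilever_eq_of_hasDerivAt {u u₁ u₂ w : ℝ → ℝ} (hw : Continuous w)
    (h : ∀ t, HasDerivAt u (u₁ t) t) (h₁ : ∀ t, HasDerivAt u₁ (u₂ t) t)
    (h₂ : ∀ t, HasDerivAt u₂ (-w t) t) (hu : u 0 = 0) (hu₁ : u₁ 0 = 0) (hu₂ : u₂ 1 = 0) :
    cantilever w = u := by
  have c₂ : Continuous u₂ := continuous_iff_continuousAt.2 fun t => (h₂ t).continuousAt
  have c₁ : Continuous u₁ := continuous_iff_continuousAt.2 fun t => (h₁ t).continuousAt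
  have e₂ : tailIntegral w = u₂ := funext fun t => by
    have := intervalIntegral.integral_eq_sub_of_hasDerivAt (fun s _ => (h₂ s).neg)
      (hw.neg.neg.intervalIntegrable t 1)
    simpa [tailIntegral, hu₂] using this
  have e₁ : headIntegral u₂ = u₁ := funext fun t => by
    simpa [headIntegral, hu₁] using intervalIntegral.integral_eq_sub_of_hasDerivAt (fun s _ => h₁ s)
      (c₂.intervalIntegrable 0 t)
  have e : headIntegral u₁ = u := funext fun t => by
    simpa [headIntegral, hu] using intervalIntegral.integral_eq_sub_of_hasDerivAt (fun s _ => h s)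
      (c₁.intervalIntegrable 0 t)
  rw [cantilever, e₂, e₁, e]

theorem continuous_kern (t : ℝ) : Continuous (kern t) :=
  Continuous.if_le (by fun_prop) (by fun_prop) continuous_const continuous_id
    fun s (hs : t = s) => by rw [hs]

/-- `kern` is the Green's function of the cantilever problem. -/
theorem integral_kern_mul {g : ℝ → ℝ} (hg : Continuous g) :
    ∀ t ∈ Icc (0:ℝ) 1, ∫ s in (0:ℝ)..1, kern t s * g s = cantilever (tailIntegral g) t := by
  have hs : ∀ j : ℕ, Continuous fun s => s ^ j * g s := fun j => by fun_prop
  let A : ℕ → ℝ → ℝ := fun j => headIntegral fun s => s ^ j * g s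
  let B : ℕ → ℝ → ℝ := fun j => tailIntegral fun s => s ^ j * g s
  have hA : ∀ j t, HasDerivAt (A j) (t ^ j * g t) t := fun j => hasDerivAt_headIntegral (hs j)
  have hB : ∀ j t, HasDerivAt (B j) (-(t ^ j * g t)) t := fun j => hasDerivAt_tailIntegral (hs j)
  have hB0 : tailIntegral g = B 0 := by simp [B]
  have key := cantilever_eq_of_hasDerivAt
    (u := fun t => t / 2 * A 2 t - A 3 t / 6 + t ^ 2 / 2 * B 1 t - t ^ 3 / 6 * B 0 t)
    (u₁ := fun t => 1 / 2 * A 2 t + t * B 1 t - t ^ 2 / 2 * B 0 t)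
    (u₂ := fun t => B 1 t - t * B 0 t) (continuous_tailIntegral hg)
    (fun t =>
      ((((((hasDerivAt_id t).div_const 2).mul (hA 2 t)).sub ((hA 3 t).div_const 6)).add
        (((hasDerivAt_pow 2 t).div_const 2).mul (hB 1 t))).sub
        (((hasDerivAt_pow 3 t).div_const 6).mul (hB 0 t))).congr_deriv (by simp; ring))
    (fun t =>
      ((((hA 2 t).const_mul (1 / 2)).add ((hasDerivAt_id t).mul (hB 1 t))).sub
        (((hasDerivAt_pow 2 t).div_const 2).mul (hB 0 t))).congr_deriv (by simp; ring))
    (fun t => by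
      rw [hB0]
      exact ((hB 1 t).sub ((hasDerivAt_id t).mul (hB 0 t))).congr_deriv (by simp))
    (by simp [A, headIntegral]) (by simp [A, headIntegral]) (by simp [B, tailIntegral])
  intro t ht
  have hk : Continuous fun s => kern t s * g s := (continuous_kern t).mul hg
  rw [key, ← intervalIntegral.integral_add_adjacent_intervals (hk.intervalIntegrable 0 t)
    (hk.intervalIntegrable t 1)]
  have e1 : ∫ s in (0:ℝ)..t, kern t s * g s = t / 2 * A 2 t - 1 / 6 * A 3 t := by
    simp only [A, headIntegral]
    rw [← intervalIntegral.integral_const_mul, ← intervalIntegral.integral_const_mul,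
      ← intervalIntegral.integral_sub (((hs 2).const_mul _).intervalIntegrable _ _)
      (((hs 3).const_mul _).intervalIntegrable _ _)]
    refine intervalIntegral.integral_congr fun s hs => ?_
    rw [uIcc_of_le ht.1] at hs
    simp only [kern]
    split_ifs with h
    · rw [le_antisymm h hs.2]; ring
    · ring
  have e2 : ∫ s in t..(1:ℝ), kern t s * g s = t ^ 2 / 2 * B 1 t - t ^ 3 / 6 * B 0 t := by
    simp only [B, tailIntegral]
    rw [← intervalIntegral.integral_const_mul, ← intervalIntegral.integral_const_mul,
      ← intervalIntegral.integral_sub (((hs 1).const_mul _).intervalIntegrable _ _)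
      (((hs 0).const_mul _).intervalIntegrable _ _)]
    refine intervalIntegral.integral_congr fun s hs => ?_
    rw [uIcc_of_le ht.2] at hs
    simp only [kern, if_pos hs.1]
    ring
  rw [e1, e2]
  ring

theorem cantilever_eq_of_eq_tailIntegral {w g : ℝ → ℝ} (hg : Continuous g) {c h : ℝ}
    (hw : ∀ t ∈ Icc (0:ℝ) 1, w t = c * (h + tailIntegral g t)) :
    ∀ t ∈ Icc (0:ℝ) 1,
      cantilever w t = c * (gam t * h + ∫ s in (0:ℝ)..1, kern t s * g s) := by
  intro t ht
  have hT := continuous_tailIntegral hg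
  have hTT := continuous_tailIntegral hT
  have hHTT := continuous_headIntegral hTT
  have h1 : cantilever w t = cantilever (fun t => c * (h + tailIntegral g t)) t :=
    headIntegral_congr (headIntegral_congr (tailIntegral_congr hw)) t ht
  have h2 := cantilever_eq_of_hasDerivAt (w := fun t => c * (h + tailIntegral g t))
    (u := fun t => c * (gam t * h + cantilever (tailIntegral g) t))
    (u₁ := fun t => c * ((t - t ^ 2 / 2) * h + headIntegral (tailIntegral (tailIntegral g)) t))
    (u₂ := fun t => c * ((1 - t) * h + tailIntegral (tailIntegral g) t)) (by fun_prop)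
    (fun t => by
      refine (HasDerivAt.add (HasDerivAt.mul_const ?_ h)
        (hasDerivAt_headIntegral hHTT t)).const_mul c
      exact ((((hasDerivAt_pow 2 t).const_mul 3).sub (hasDerivAt_pow 3 t)).div_const 6).congr_deriv
        (by simp; ring))
    (fun t => by
      refine (HasDerivAt.add (HasDerivAt.mul_const ?_ h)
        (hasDerivAt_headIntegral hTT t)).const_mul c
      exact ((hasDerivAt_id t).sub ((hasDerivAt_pow 2 t).div_const 2)).congr_deriv (by simp))
    (fun t =>
      ((HasDerivAt.add (((hasDerivAt_id t).const_sub 1).mul_const h)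
        (hasDerivAt_tailIntegral hT t)).const_mul c).congr_deriv (by ring))
    (by simp [gam, cantilever, headIntegral]) (by simp [headIntegral]) (by simp [tailIntegral])
  rw [h1, h2, integral_kern_mul hg t ht]

/-- The admissible third-derivative profiles: `[0, ρ]`-valued `L`-Lipschitz functions on `[0,1]`
with value `ρ` at `0`. -/
def profileSet (ρ : ℝ) (L : NNReal) : Set C(Icc (0:ℝ) 1, ℝ) :=
  {v | (∀ t, v t ∈ Icc 0 ρ) ∧ v 0 = ρ ∧ LipschitzWith L v}

theorem profileSet_nonempty {ρ : ℝ} (hρ : 0 ≤ ρ) (L : NNReal) : (profileSet ρ L).Nonempty :=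
  ⟨ContinuousMap.const _ ρ, fun _ => ⟨hρ, le_rfl⟩, rfl, (LipschitzWith.const ρ).weaken zero_le⟩

theorem convex_profileSet (ρ : ℝ) (L : NNReal) : Convex ℝ (profileSet ρ L) := by
  rintro v ⟨hv, hv0, hvL⟩ w ⟨hw, hw0, hwL⟩ a b ha hb hab
  refine ⟨fun t => convex_Icc 0 ρ (hv t) (hw t) ha hb hab, ?_, ?_⟩
  · simp [hv0, hw0, ← add_mul, hab]
  · refine LipschitzWith.of_dist_le_mul fun s t => ?_
    have h1 := hvL.dist_le_mul s t
    have h2 := hwL.dist_le_mul s t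
    rw [Real.dist_eq] at h1 h2 ⊢
    have e : (a • v + b • w) s - (a • v + b • w) t = a * (v s - v t) + b * (w s - w t) := by
      simp
      ring
    rw [e]
    calc |a * (v s - v t) + b * (w s - w t)| ≤ a * |v s - v t| + b * |w s - w t| := by
          refine (abs_add_le _ _).trans_eq ?_
          rw [abs_mul, abs_mul, abs_of_nonneg ha, abs_of_nonneg hb]
      _ ≤ a * (L * dist s t) + b * (L * dist s t) := by gcongr
      _ = L * dist s t := by rw [← add_mul, hab, one_mul]

theorem isCompact_profileSet (ρ : ℝ) (L : NNReal) : IsCompact (profileSet ρ L) := by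
  refine ArzelaAscoli.isCompact_of_equicontinuous _ ?_ ?_
  · have e : ContinuousMap.toFun '' profileSet ρ L =
        (univ.pi fun _ => Icc 0 ρ) ∩ ({v | v 0 = ρ} ∩ {v | LipschitzWith L v}) := by
      ext v
      constructor
      · rintro ⟨v, ⟨h1, h2, h3⟩, rfl⟩
        exact ⟨fun t _ => h1 t, h2, h3⟩
      · rintro ⟨h1, h2, h3⟩
        exact ⟨⟨v, h3.continuous⟩, ⟨fun t => h1 t trivial, h2, h3⟩, rfl⟩
    rw [e]
    exact (isCompact_univ_pi fun _ => isCompact_Icc).inter_right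
      ((isClosed_eq (continuous_apply _) continuous_const).inter (isClosed_setOfPred_lipschitzWith L))
  · exact (LipschitzWith.uniformEquicontinuous _ L fun v => v.2.2.2).equicontinuous

/-- Existence of a profile reproduced, up to normalization, by `h v + ∫ g v` over `[t, 1]`. -/
theorem exists_profile_eq_tailIntegral {ρ c M : ℝ} (hρ : 0 < ρ) (hc : 0 < c)
    {L : NNReal} (hL : L = ρ * M / c) {h : C(Icc (0:ℝ) 1, ℝ) → ℝ} {g : C(Icc (0:ℝ) 1, ℝ) → ℝ → ℝ}
    (hh : ContinuousOn h (profileSet ρ L))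
    (hg : Continuous fun p : C(Icc (0:ℝ) 1, ℝ) × ℝ => g p.1 p.2)
    (hgM : ∀ v s, g v s ∈ Icc 0 M) (h0 : ∀ v ∈ profileSet ρ L, 0 ≤ h v)
    (hden : ∀ v ∈ profileSet ρ L, c ≤ h v + tailIntegral (g v) 0) :
    ∃ v ∈ profileSet ρ L, ∀ t : Icc (0:ℝ) 1,
      v t = ρ / (h v + tailIntegral (g v) 0) * (h v + tailIntegral (g v) t) := by
  have hgv : ∀ v, Continuous (g v) := fun v => hg.comp (by fun_prop : Continuous fun s => (v, s))
  let Φ : C(Icc (0:ℝ) 1, ℝ) → C(Icc (0:ℝ) 1, ℝ) := fun v =>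
    ⟨fun t => ρ / (h v + tailIntegral (g v) 0) * (h v + tailIntegral (g v) t),
      continuous_const.mul (continuous_const.add
        ((continuous_tailIntegral (hgv v)).comp continuous_subtype_val))⟩
  have hΦ : ContinuousOn Φ (profileSet ρ L) := by
    rw [continuousOn_iff_continuous_domRestrict]
    refine ContinuousMap.continuous_of_continuous_uncurry _ ?_
    have hT := continuous_tailIntegral_uncurry hg
    have hr : Continuous fun p : profileSet ρ L × Icc (0:ℝ) 1 => h p.1 :=
      (continuousOn_iff_continuous_domRestrict.1 hh).comp continuous_fst
    have hT0 : Continuous fun p : profileSet ρ L × Icc (0:ℝ) 1 => tailIntegral (g p.1) 0 :=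
      hT.comp (by fun_prop : Continuous fun p : profileSet ρ L × Icc (0:ℝ) 1 => (p.1.1, (0:ℝ)))
    have hTt : Continuous fun p : profileSet ρ L × Icc (0:ℝ) 1 => tailIntegral (g p.1) p.2 :=
      hT.comp (by fun_prop :
        Continuous fun p : profileSet ρ L × Icc (0:ℝ) 1 => (p.1.1, (p.2 : ℝ)))
    exact (continuous_const.div (hr.add hT0) fun p =>
      (hc.trans_le (hden p.1 p.1.2)).ne').mul (hr.add hTt)
  have hmaps : MapsTo Φ (profileSet ρ L) (profileSet ρ L) := by
    intro v hv
    have hd := hden v hv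
    have hd0 : 0 < h v + tailIntegral (g v) 0 := hc.trans_le hd
    have hsub : ∀ s t : ℝ, tailIntegral (g v) s - tailIntegral (g v) t = ∫ x in s..t, g v x :=
      fun s t => sub_eq_of_eq_add (intervalIntegral.integral_add_adjacent_intervals
        ((hgv v).intervalIntegrable s t) ((hgv v).intervalIntegrable t 1)).symm
    refine ⟨fun t => ⟨?_, ?_⟩, div_mul_cancel₀ _ hd0.ne', ?_⟩
    · exact mul_nonneg (div_nonneg hρ.le hd0.le) (add_nonneg (h0 v hv)
        (tailIntegral_nonneg (fun s _ => (hgM v s).1) t t.2))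
    · have hle : tailIntegral (g v) t ≤ tailIntegral (g v) 0 := by
        rw [← sub_nonneg, hsub]
        exact intervalIntegral.integral_nonneg t.2.1 fun s _ => (hgM v s).1
      calc ρ / (h v + tailIntegral (g v) 0) * (h v + tailIntegral (g v) t)
          ≤ ρ / (h v + tailIntegral (g v) 0) * (h v + tailIntegral (g v) 0) := by gcongr
        _ = ρ := div_mul_cancel₀ _ hd0.ne'
    · refine LipschitzWith.of_dist_le_mul fun s t => ?_
      have hI : |tailIntegral (g v) s - tailIntegral (g v) t| ≤ M * dist s t := by
        rw [hsub, dist_comm, Subtype.dist_eq, Real.dist_eq]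
        exact intervalIntegral.norm_integral_le_of_norm_le_const (f := g v) fun x _ =>
          (abs_of_nonneg (hgM v x).1).trans_le (hgM v x).2
      calc dist (Φ v s) (Φ v t)
          = ρ / (h v + tailIntegral (g v) 0) *
              |tailIntegral (g v) s - tailIntegral (g v) t| := by
            change |ρ / (h v + tailIntegral (g v) 0) * (h v + tailIntegral (g v) s) -
              ρ / (h v + tailIntegral (g v) 0) * (h v + tailIntegral (g v) t)| = _
            rw [← mul_sub, abs_mul, abs_of_nonneg (div_nonneg hρ.le hd0.le), add_sub_add_left_eq_sub]
        _ ≤ ρ / c * (M * dist s t) := by gcongr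
        _ = L * dist s t := by rw [hL]; ring
  obtain ⟨v, hv, he⟩ := exists_fixedPoint_of_isCompact_convex (isCompact_profileSet ρ L)
    (convex_profileSet ρ L) (profileSet_nonempty hρ.le L) hΦ hmaps
  exact ⟨v, hv, fun t => (DFunLike.congr_fun he t).symm⟩

theorem isCompact_PiSet (ρ : ℝ) : IsCompact (PiSet ρ) := by
  have e : PiSet ρ = Icc (0:ℝ) 1 ×ˢ Icc 0 ρ ×ˢ Icc 0 ρ ×ˢ Icc 0 ρ ×ˢ Icc (-ρ) 0 := rfl
  rw [e]
  exact isCompact_Icc.prod (isCompact_Icc.prod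
    (isCompact_Icc.prod (isCompact_Icc.prod isCompact_Icc)))

/-- A continuous function on `PiSet ρ` extends to a continuous function on the whole space with
values in the original range. -/
theorem exists_continuous_extend_PiSet {ρ : ℝ} (hρ : 0 ≤ ρ) {f : ℝ × ℝ × ℝ × ℝ × ℝ → ℝ}
    (hf : ContinuousOn f (PiSet ρ)) :
    ∃ F : ℝ × ℝ × ℝ × ℝ × ℝ → ℝ, Continuous F ∧ EqOn F f (PiSet ρ) ∧
      ∀ p, F p ∈ f '' PiSet ρ := by
  have h1 : (0:ℝ) ≤ 1 := zero_le_one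
  have h2 : -ρ ≤ 0 := neg_nonpos.2 hρ
  let r : ℝ × ℝ × ℝ × ℝ × ℝ → ℝ × ℝ × ℝ × ℝ × ℝ := fun p =>
    (projIcc 0 1 h1 p.1, projIcc 0 ρ hρ p.2.1, projIcc 0 ρ hρ p.2.2.1,
      projIcc 0 ρ hρ p.2.2.2.1, projIcc (-ρ) 0 h2 p.2.2.2.2)
  have hr : Continuous r := by fun_prop
  have hmem : ∀ p, r p ∈ PiSet ρ := fun p =>
    ⟨Subtype.property _, Subtype.property _, Subtype.property _, Subtype.property _,
      Subtype.property _⟩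
  refine ⟨f ∘ r, hf.comp_continuous hr hmem, fun p hp => ?_, fun p => ⟨r p, hmem p, rfl⟩⟩
  obtain ⟨p1, p2, p3, p4, p5⟩ := p
  obtain ⟨q1, q2, q3, q4, q5⟩ := hp
  simp only [Function.comp_apply, r, projIcc_of_mem _ q1, projIcc_of_mem _ q2, projIcc_of_mem _ q3,
    projIcc_of_mem _ q4, projIcc_of_mem _ q5]

theorem continuousOn_comp_cantilever {H : (ℝ → ℝ) → ℝ} {ρ : ℝ} (hH : ContOn3 H (Kbar ρ))
    {S : Set C(Icc (0:ℝ) 1, ℝ)}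
    (hS : ∀ v ∈ S, cantilever (IccExtend zero_le_one v) ∈ Kbar ρ) :
    ContinuousOn (fun v : C(Icc (0:ℝ) 1, ℝ) => H (cantilever (IccExtend zero_le_one v))) S := by
  rw [Metric.continuousOn_iff]
  intro v hv ε hε
  obtain ⟨δ, hδ, h⟩ := hH _ (hS v hv) ε hε
  refine ⟨δ, hδ, fun w hw hwv => ?_⟩
  rw [dist_comm, Real.dist_eq]
  refine h _ (hS w hw) ?_
  have hc : ∀ v : C(Icc (0:ℝ) 1, ℝ), Continuous (IccExtend zero_le_one v) :=
    fun v => v.continuous.Icc_extend'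
  rw [← cantilever_sub (hc v) (hc w)]
  refine (norm3_cantilever_le ((hc v).sub (hc w)) fun t _ => ?_).trans_lt hwv
  rw [dist_comm w v]
  exact ContinuousMap.dist_apply_le_dist (f := v) (g := w) (projIcc 0 1 zero_le_one t)

/-- Corollary 2.3: if the hypotheses (a), (b), (c) of Theorem 2.2 hold for every
`ρ ∈ (0,∞)`, then for every `ρ ∈ (0,∞)` there exist `λ_ρ ∈ (0,∞)` and a non-negative
eigenfunction `u_ρ ∈ ∂K_ρ` satisfying the perturbed Hammerstein integral equation. -/
theorem exists_eigenpair_for_every_rho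
    (f : ℝ × ℝ × ℝ × ℝ × ℝ → ℝ)
    (δlo : ℝ → ℝ → ℝ) (η : ℝ → ℝ) (H : (ℝ → ℝ) → ℝ)
    (hfc : ∀ ρ > (0:ℝ), ContinuousOn f (PiSet ρ))
    (hδc : ∀ ρ > (0:ℝ), ContinuousOn (δlo ρ) (Icc 0 1))
    (hδ0 : ∀ ρ > (0:ℝ), ∀ t ∈ Icc (0:ℝ) 1, 0 ≤ δlo ρ t)
    (hfδ : ∀ ρ > (0:ℝ), ∀ p ∈ PiSet ρ, δlo ρ p.1 ≤ f p)
    (hHc : ∀ ρ > (0:ℝ), ContOn3 H (Kbar ρ))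
    (hHb : ∀ ρ > (0:ℝ), BddOn3 H (Kbar ρ))
    (hη0 : ∀ ρ > (0:ℝ), 0 ≤ η ρ)
    (hHη : ∀ ρ > (0:ℝ), ∀ u ∈ Kbdry ρ, η ρ ≤ H u)
    (hpos : ∀ ρ > (0:ℝ), 0 < η ρ + ∫ s in (0:ℝ)..1, δlo ρ s) :
    ∀ ρ > (0:ℝ), ∃ lam : ℝ, 0 < lam ∧ ∃ u ∈ Kbdry ρ,
      (∀ t ∈ Icc (0:ℝ) 1, 0 ≤ u t) ∧
      ∀ t ∈ Icc (0:ℝ) 1, u t = lam * Toper f H u t := by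
  intro ρ hρ
  obtain ⟨F, hFc, hFf, hFr⟩ := exists_continuous_extend_PiSet hρ.le (hfc ρ hρ)
  obtain ⟨M, hM⟩ := (isCompact_PiSet ρ).bddAbove_image (hfc ρ hρ)
  have hFM : ∀ p, F p ∈ Icc 0 M := fun p => by
    refine ⟨?_, hM (hFr p)⟩
    obtain ⟨q, hq, e⟩ := hFr p
    exact e ▸ (hδ0 ρ hρ _ hq.1).trans (hfδ ρ hρ q hq)
  have hM0 : 0 ≤ M := (hFM 0).1.trans (hFM 0).2
  let W : C(Icc (0:ℝ) 1, ℝ) → ℝ → ℝ := fun v => IccExtend zero_le_one v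
  have hW : Continuous fun p : C(Icc (0:ℝ) 1, ℝ) × ℝ => W p.1 p.2 :=
    ContinuousEval.continuous_eval.comp
      (continuous_fst.prodMk ((continuous_projIcc (h := zero_le_one)).comp continuous_snd))
  have hWv : ∀ v, Continuous (W v) := fun v => v.continuous.Icc_extend'
  let g : C(Icc (0:ℝ) 1, ℝ) → ℝ → ℝ := fun v s =>
    F (s, cantilever (W v) s, headIntegral (tailIntegral (W v)) s, tailIntegral (W v) s, -W v s)
  have hg : Continuous fun p : C(Icc (0:ℝ) 1, ℝ) × ℝ => g p.1 p.2 := by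
    have h1 := continuous_tailIntegral_uncurry hW
    have h2 := continuous_headIntegral_uncurry (w := fun v => tailIntegral (W v)) h1
    have h3 := continuous_headIntegral_uncurry
      (w := fun v => headIntegral (tailIntegral (W v))) h2
    exact hFc.comp (continuous_snd.prodMk (h3.prodMk (h2.prodMk (h1.prodMk hW.neg))))
  have hgv : ∀ v, Continuous (g v) := fun v => hg.comp (by fun_prop : Continuous fun s => (v, s))
  let c := η ρ + ∫ s in (0:ℝ)..1, δlo ρ s
  have hc : 0 < c := hpos ρ hρ
  have hL0 : 0 ≤ ρ * M / c := by positivity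
  let S := profileSet ρ ⟨ρ * M / c, hL0⟩
  have hWS : ∀ v ∈ S, ∀ t ∈ Icc (0:ℝ) 1, W v t ∈ Icc 0 ρ := fun v hv t _ => hv.1 _
  have hbdry : ∀ v ∈ S, cantilever (W v) ∈ Kbdry ρ := fun v hv =>
    cantilever_mem_Kbdry (hWv v) (hWS v hv) ((IccExtend_left zero_le_one v).trans hv.2.1)
  have hgf : ∀ v ∈ S, ∀ s ∈ Icc (0:ℝ) 1, g v s = f (s, cantilever (W v) s,
      headIntegral (tailIntegral (W v)) s, tailIntegral (W v) s, -W v s) := fun v hv s hs =>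
    hFf (mem_PiSet_cantilever (hWS v hv) s hs)
  have hH0 : ∀ v ∈ S, η ρ ≤ H (cantilever (W v)) := fun v hv => hHη ρ hρ _ (hbdry v hv)
  have hden : ∀ v ∈ S, c ≤ H (cantilever (W v)) + tailIntegral (g v) 0 := fun v hv => by
    refine add_le_add (hH0 v hv) (intervalIntegral.integral_mono_on zero_le_one ?_
      ((hgv v).intervalIntegrable 0 1) fun s hs => ?_)
    · exact ContinuousOn.intervalIntegrable_of_Icc zero_le_one (hδc ρ hρ)
    · rw [hgf v hv s hs]
      exact hfδ ρ hρ _ (mem_PiSet_cantilever (hWS v hv) s hs)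
  obtain ⟨v, hv, he⟩ := exists_profile_eq_tailIntegral hρ hc (L := ⟨ρ * M / c, hL0⟩) rfl
    (continuousOn_comp_cantilever (hHc ρ hρ) fun v hv =>
      ⟨(hbdry v hv).1, (hbdry v hv).2.le⟩) hg (fun v s => hFM _)
    (fun v hv => (hη0 ρ hρ).trans (hH0 v hv)) hden
  refine ⟨ρ / (H (cantilever (W v)) + tailIntegral (g v) 0),
    div_pos hρ (hc.trans_le (hden v hv)), cantilever (W v), hbdry v hv,
    fun t ht => ((hbdry v hv).1.2 t ht).1, fun t ht => ?_⟩
  rw [cantilever_eq_of_eq_tailIntegral (hgv v)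
    (fun s hs => (IccExtend_of_mem zero_le_one v hs).trans (he ⟨s, hs⟩)) t ht]
  simp only [Toper, deriv_cantilever (hWv v), iterate_two_deriv_cantilever (hWv v),
    iterate_three_deriv_cantilever (hWv v)]
  congr 2
  refine intervalIntegral.integral_congr fun s hs => ?_
  rw [uIcc_of_le zero_le_one] at hs
  exact congrArg _ (hgf v hv s hs)
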